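/- arXiv:1705.00924 — 3 statements merged into one kernel-verified Lean document; each statement's English description precedes it below -/
import Mathlib

section
/- Let T ⊆ ℝ² be a closed non-acute triangle (the convex hull of three non-collinear points, one of whose interior angles is at least π/2) and let a be the area of its incircle. Then every finite multiset of positive real numbers whose sum is at most a can be packed into T. (Packing direction of the main triangle theorem.) -/
noncomputable section

abbrev Plane := EuclideanSpace ℝ (Fin 2)

/-- A finite multiset of positive reals `C`, interpreted as circle areas, can be packed
into `S ⊆ ℝ²`: each area `a` gets a center such that the closed disk of radius `√(a/π)`
lies in `S`, and the open disks are pairwise disjoint. -/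
def Packs (C : Multiset ℝ) (S : Set Plane) : Prop :=
  ∃ l : List (ℝ × Plane),
    (↑(l.map Prod.fst) : Multiset ℝ) = C ∧
    (∀ p ∈ l, Metric.closedBall p.2 (Real.sqrt (p.1 / Real.pi)) ⊆ S) ∧
    l.Pairwise fun p q =>
      Disjoint (Metric.ball p.2 (Real.sqrt (p.1 / Real.pi)))
               (Metric.ball q.2 (Real.sqrt (q.1 / Real.pi)))

/-- Area of a triangle with side lengths `x, y, z` by Heron's formula. -/
def heronArea (x y z : ℝ) : ℝ :=
  Real.sqrt (((x + y + z) / 2) * ((x + y + z) / 2 - x) *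
    ((x + y + z) / 2 - y) * ((x + y + z) / 2 - z))

/-- Area of the incircle of a triangle with side lengths `x, y, z`:
`π (Δ/s)²` where `Δ` is the area and `s` the semiperimeter. -/
def incircleArea (x y z : ℝ) : ℝ :=
  Real.pi * (heronArea x y z / ((x + y + z) / 2)) ^ 2

open scoped RealInnerProductSpace

/-- Radius of the circle of area `a`. -/
def circleRadius (a : ℝ) : ℝ := Real.sqrt (a / Real.pi)

lemma circleRadius_nonneg (a : ℝ) : 0 ≤ circleRadius a := Real.sqrt_nonneg _

lemma pi_mul_circleRadius_sq {a : ℝ} (ha : 0 ≤ a) : Real.pi * circleRadius a ^ 2 = a := by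
  rw [circleRadius, Real.sq_sqrt (by positivity)]
  field_simp

lemma circleRadius_mono {a b : ℝ} (h : a ≤ b) : circleRadius a ≤ circleRadius b :=
  Real.sqrt_le_sqrt (by gcongr)

/-- Greedy weighted splitting: within each part, removing any single element makes the part
at most proportional to the other one. -/
lemma exists_greedy_split_list {w₁ w₂ : ℝ} (hw₁ : 0 ≤ w₁) (hw₂ : 0 ≤ w₂) (l : List ℝ)
    (hl : l.Pairwise (· ≤ ·)) (hpos : ∀ x ∈ l, 0 < x) :
    ∃ C₁ C₂ : Multiset ℝ, (l : Multiset ℝ) = C₁ + C₂ ∧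
      (∀ x ∈ C₁, w₂ * (C₁.sum - x) ≤ w₁ * C₂.sum) ∧
      (∀ x ∈ C₂, w₁ * (C₂.sum - x) ≤ w₂ * C₁.sum) := by
  induction l with
  | nil => exact ⟨0, 0, by simp⟩
  | cons y l ih =>
    rw [List.pairwise_cons] at hl
    obtain ⟨C₁, C₂, h, h₁, h₂⟩ := ih hl.2 fun x hx => hpos x (List.mem_cons_of_mem _ hx)
    have hy : 0 < y := hpos y List.mem_cons_self
    have hle : ∀ x ∈ C₁ + C₂, y ≤ x := by
      intro x hx
      rw [← h] at hx
      exact hl.1 x (by simpa using hx)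
    rcases le_total (w₂ * C₁.sum) (w₁ * C₂.sum) with hc | hc
    · refine ⟨y ::ₘ C₁, C₂, by rw [← Multiset.cons_coe, h, Multiset.cons_add], ?_, ?_⟩
      · intro x hx
        have hyx : y ≤ x := by
          rcases Multiset.mem_cons.1 hx with rfl | hx
          · exact le_rfl
          · exact hle x (Multiset.mem_add.2 (Or.inl hx))
        rw [Multiset.sum_cons]
        nlinarith
      · intro x hx
        rw [Multiset.sum_cons]
        nlinarith [h₂ x hx]
    · refine ⟨C₁, y ::ₘ C₂, by rw [← Multiset.cons_coe, h, Multiset.add_cons], ?_, ?_⟩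
      · intro x hx
        rw [Multiset.sum_cons]
        nlinarith [h₁ x hx]
      · intro x hx
        have hyx : y ≤ x := by
          rcases Multiset.mem_cons.1 hx with rfl | hx
          · exact le_rfl
          · exact hle x (Multiset.mem_add.2 (Or.inr hx))
        rw [Multiset.sum_cons]
        nlinarith

lemma card_le_one_of_sum_le {C : Multiset ℝ} (hpos : ∀ x ∈ C, 0 < x)
    (h : ∀ x ∈ C, C.sum ≤ x) : C.card ≤ 1 := by
  induction C using Multiset.induction with
  | empty => simp
  | cons y C _ =>
    rcases C.empty_or_exists_mem with rfl | ⟨z, hz⟩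
    · simp
    · have h₁ := h y (Multiset.mem_cons_self _ _)
      have h₂ := Multiset.single_le_sum
        (fun x hx => (hpos x (Multiset.mem_cons_of_mem hx)).le) z hz
      have h₃ := hpos z (Multiset.mem_cons_of_mem hz)
      rw [Multiset.sum_cons] at h₁
      linarith

lemma exists_greedy_split {w₁ w₂ : ℝ} (hw₁ : 0 < w₁) (hw₂ : 0 < w₂) (C : Multiset ℝ)
    (hpos : ∀ x ∈ C, 0 < x) (hcard : 1 < C.card) :
    ∃ C₁ C₂ : Multiset ℝ, C = C₁ + C₂ ∧ C₁ ≠ 0 ∧ C₂ ≠ 0 ∧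
      (∀ x ∈ C₁, w₂ * (C₁.sum - x) ≤ w₁ * C₂.sum) ∧
      (∀ x ∈ C₂, w₁ * (C₂.sum - x) ≤ w₂ * C₁.sum) := by
  obtain ⟨C₁, C₂, h, h₁, h₂⟩ := exists_greedy_split_list hw₁.le hw₂.le (C.sort (· ≤ ·))
    (C.pairwise_sort _) (fun x hx => hpos x ((Multiset.mem_sort _).1 hx))
  rw [Multiset.sort_eq] at h
  refine ⟨C₁, C₂, h, ?_, ?_, h₁, h₂⟩
  · rintro rfl
    rw [zero_add] at h
    subst h
    refine absurd (card_le_one_of_sum_le hpos fun x hx => ?_) hcard.not_ge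
    have := h₂ x hx
    simp only [Multiset.sum_zero, mul_zero] at this
    nlinarith
  · rintro rfl
    rw [add_zero] at h
    subst h
    refine absurd (card_le_one_of_sum_le hpos fun x hx => ?_) hcard.not_ge
    have := h₁ x hx
    simp only [Multiset.sum_zero, mul_zero] at this
    nlinarith

/-- A lower bound on `ρ`, coming from the greedy splitting, that keeps a disk of radius `ρ` in a
corner triangle of inradius `S` from crossing the opposite side. -/
lemma overhang_bound {D w₁ w₂ R S ρ : ℝ} (hw₁ : 0 < w₁) (hD : w₁ < D) (hw₂ : 0 < w₂)
    (hDw : D ^ 2 ≤ w₁ ^ 2 + w₂ ^ 2) (hρ : 0 ≤ ρ) (hS : 0 ≤ S) (hSR : S ≤ R)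
    (h : w₂ ^ 2 * (S ^ 2 - ρ ^ 2) ≤ w₁ ^ 2 * (R ^ 2 - S ^ 2)) :
    (D - w₁) * (R - ρ) ≤ D * (R - S) := by
  by_contra! hlt
  have hlt' : (D - w₁) * ρ < D * S - w₁ * R := by linarith
  have hD₁ : 0 < D - w₁ := sub_pos.2 hD
  have hG : 0 < D * S - w₁ * R := lt_of_le_of_lt (by positivity) hlt'
  have hsq : ((D - w₁) * ρ) ^ 2 < (D * S - w₁ * R) ^ 2 := by gcongr
  have h₁ : 0 ≤ (D - w₁) * (D * S - w₁ * R) * (2 * D * w₁ * (R - S)) := by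
    have := sub_nonneg.2 hSR
    have := hw₁.trans hD
    positivity
  have h₂ : 0 ≤ (w₁ ^ 2 + w₂ ^ 2 - D ^ 2) *
      (w₁ * (R - S) * ((D * S - w₁ * R) + (D - w₁) * S)) := by
    have := sub_nonneg.2 hSR
    have := sub_nonneg.2 hDw
    positivity
  have h₃ : 0 ≤ (D - w₁) ^ 2 * (w₁ ^ 2 * (R ^ 2 - S ^ 2) - w₂ ^ 2 * (S ^ 2 - ρ ^ 2)) :=
    mul_nonneg (sq_nonneg _) (sub_nonneg.2 h)
  have h₄ : 0 < w₂ ^ 2 * ((D * S - w₁ * R) ^ 2 - ((D - w₁) * ρ) ^ 2) :=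
    mul_pos (by positivity) (sub_pos.2 hsq)
  nlinarith

lemma base_lengths_le {u v R S₁ S₂ : ℝ} (hu : 0 < u) (hv : 0 < v) (huv : 1 + u + v ≤ u * v)
    (hR : 0 ≤ R) (h : S₁ ^ 2 + S₂ ^ 2 = R ^ 2) :
    S₁ * (1 + u) + S₂ * (1 + v) ≤ R * (u + v) := by
  apply le_of_sq_le_sq _ (by positivity)
  have h₁ : 0 ≤ (S₁ * (1 + v) - S₂ * (1 + u)) ^ 2 := sq_nonneg _
  have h₂ : (0 : ℝ) ≤ R ^ 2 * (u * v - (1 + u + v)) :=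
    mul_nonneg (sq_nonneg _) (sub_nonneg.2 huv)
  linear_combination h₁ + 2 * h₂ + ((1 + u) ^ 2 + (1 + v) ^ 2) * h

lemma weights_bound {u v : ℝ} (hu : 1 < u) (hv : 1 < v) (huv : 1 + u + v ≤ u * v) :
    (u * v - 1) ^ 2 ≤ (v * (u - 1)) ^ 2 + (u * (v - 1)) ^ 2 := by
  have h₀ : 0 < (u + v) ^ 2 := by positivity
  refine le_of_mul_le_mul_left ?_ h₀
  have h₁ : 0 ≤ ((1 + v) * (v * (u - 1)) - (1 + u) * (u * (v - 1))) ^ 2 := sq_nonneg _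
  have h₂ : 0 ≤ ((v * (u - 1)) ^ 2 + (u * (v - 1)) ^ 2) * (2 * (u * v - (1 + u + v))) := by
    have := sub_nonneg.2 huv
    positivity
  nlinarith

/-- The disk with center `x` and radius `ρ` satisfies the three side constraints of the triangle
with incenter `I` and inradius `R` whose base has inward unit normal `f` and direction `e`, and
whose base angles have half-angle cotangents `u` and `v`. -/
def DiskInTriangle {V : Type*} [NormedAddCommGroup V] [InnerProductSpace ℝ V]
    (e f : V) (u v : ℝ) (I : V) (R : ℝ) (x : V) (ρ : ℝ) : Prop :=
  ρ - R ≤ ⟪f, x - I⟫ ∧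
  (1 + u ^ 2) * (ρ - R) ≤ 2 * u * ⟪e, x - I⟫ - (u ^ 2 - 1) * ⟪f, x - I⟫ ∧
  (1 + v ^ 2) * (ρ - R) ≤ -(2 * v * ⟪e, x - I⟫) - (v ^ 2 - 1) * ⟪f, x - I⟫

lemma DiskInTriangle.flip {V : Type*} [NormedAddCommGroup V] [InnerProductSpace ℝ V]
    {e f : V} {u v : ℝ} {I : V} {R : ℝ} {x : V} {ρ : ℝ}
    (h : DiskInTriangle (-e) f v u I R x ρ) : DiskInTriangle e f u v I R x ρ := by
  obtain ⟨h₁, h₂, h₃⟩ := h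
  rw [inner_neg_left] at h₂ h₃
  exact ⟨h₁, by linarith, by linarith⟩

/-- The circles in `l` have areas `C`, do not overlap, and each satisfies `P center radius`. -/
def IsPacking {V : Type*} [NormedAddCommGroup V]
    (C : Multiset ℝ) (P : V → ℝ → Prop) (l : List (ℝ × V)) : Prop :=
  (↑(l.map Prod.fst) : Multiset ℝ) = C ∧
  (∀ p ∈ l, P p.2 (circleRadius p.1)) ∧
  l.Pairwise fun p q => circleRadius p.1 + circleRadius q.1 ≤ dist p.2 q.2

lemma IsPacking.imp {V : Type*} [NormedAddCommGroup V]
    {C : Multiset ℝ} {P Q : V → ℝ → Prop} {l : List (ℝ × V)}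
    (h : IsPacking C P l) (hPQ : ∀ c ∈ C, ∀ x, P x (circleRadius c) → Q x (circleRadius c)) :
    IsPacking C Q l := by
  refine ⟨h.1, fun p hp => hPQ _ ?_ _ (h.2.1 p hp), h.2.2⟩
  rw [← h.1]
  exact Multiset.mem_coe.2 (List.mem_map_of_mem hp)

lemma IsPacking.append {V : Type*} [NormedAddCommGroup V]
    {C₁ C₂ : Multiset ℝ} {P₁ P₂ P : V → ℝ → Prop} {l₁ l₂ : List (ℝ × V)}
    (h₁ : IsPacking C₁ P₁ l₁) (h₂ : IsPacking C₂ P₂ l₂)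
    (hP₁ : ∀ x ρ, P₁ x ρ → P x ρ) (hP₂ : ∀ x ρ, P₂ x ρ → P x ρ)
    (hsep : ∀ x ρ y σ, P₁ x ρ → P₂ y σ → ρ + σ ≤ dist x y) :
    IsPacking (C₁ + C₂) P (l₁ ++ l₂) := by
  refine ⟨?_, ?_, ?_⟩
  · rw [← h₁.1, ← h₂.1, List.map_append, Multiset.coe_add]
  · intro p hp
    rcases List.mem_append.1 hp with hp | hp
    · exact hP₁ _ _ (h₁.2.1 p hp)
    · exact hP₂ _ _ (h₂.2.1 p hp)
  · rw [List.pairwise_append]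
    exact ⟨h₁.2.2, h₂.2.2, fun p hp q hq => hsep _ _ _ _ (h₁.2.1 p hp) (h₂.2.1 q hq)⟩

/-- The statement that `C` packs into every non-acute triangle whose incircle has area
`C.sum`. -/
def PacksNonacute (V : Type*) [NormedAddCommGroup V] [InnerProductSpace ℝ V]
    (C : Multiset ℝ) : Prop :=
  ∀ (e f : V) (u v : ℝ) (I : V), ‖e‖ = 1 → ‖f‖ = 1 → ⟪e, f⟫ = 0 → 1 < u → 1 < v →
    1 + u + v ≤ u * v →
    ∃ l, IsPacking C (DiskInTriangle e f u v I (circleRadius C.sum)) l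

/-- A disk in the right triangle of inradius `S` that shares the left base corner with the
triangle of inradius `R` lies in the latter triangle, unless the disk is small. -/
lemma diskInTriangle_of_constraints {u v R S ρ X Y : ℝ} (hu : 1 < u) (hv : 1 < v)
    (hρ : (v - 1) * (R - ρ) ≤ (u * v - 1) * (R - S))
    (h₂ : (1 + u ^ 2) * (ρ - R) ≤ 2 * u * X - (u ^ 2 - 1) * Y)
    (h₃ : X + ρ ≤ (S - R) * u + S) :
    (1 + v ^ 2) * (ρ - R) ≤ -(2 * v * X) - (v ^ 2 - 1) * Y := by
  have hu' : 0 < u ^ 2 - 1 := by nlinarith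
  have hv' : 0 < v ^ 2 - 1 := by nlinarith
  have huv : 0 < u * v - 1 := by nlinarith
  refine le_of_mul_le_mul_left ?_ hu'
  have k₁ := mul_le_mul_of_nonneg_left h₂ hv'.le
  have k₂ := mul_le_mul_of_nonneg_left h₃
    (show 0 ≤ 2 * (u + v) * (u * v - 1) by positivity)
  have k₃ := mul_le_mul_of_nonneg_left hρ (show 0 ≤ 2 * (u + v) * (u + 1) by positivity)
  nlinarith

lemma exists_corner_packing {V : Type*} [NormedAddCommGroup V] [InnerProductSpace ℝ V]
    {C : Multiset ℝ} (hC : PacksNonacute V C) {e f : V} {u v R : ℝ}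
    (I : V) (he : ‖e‖ = 1) (hf : ‖f‖ = 1) (hef : ⟪e, f⟫ = 0) (hu : 1 < u) (hv : 1 < v)
    (hρ : ∀ c ∈ C, (v - 1) * (R - circleRadius c) ≤
      (u * v - 1) * (R - circleRadius C.sum)) :
    ∃ l, IsPacking C (fun x ρ => DiskInTriangle e f u v I R x ρ ∧
      ⟪e, x - I⟫ + ρ ≤ (circleRadius C.sum - R) * u + circleRadius C.sum) l := by
  set S := circleRadius C.sum
  have hee : ⟪e, e⟫ = 1 := by rw [real_inner_self_eq_norm_sq, he, one_pow]
  have hff : ⟪f, f⟫ = 1 := by rw [real_inner_self_eq_norm_sq, hf, one_pow]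
  have hfe : ⟪f, e⟫ = 0 := by rw [real_inner_comm, hef]
  have hu₁ : 0 < u - 1 := sub_pos.2 hu
  have hu₂ : 0 < 1 + u ^ 2 := by positivity
  set s := 2 * u / (1 + u ^ 2) with hs
  set c := (u ^ 2 - 1) / (1 + u ^ 2) with hc
  have hs' : (1 + u ^ 2) * s = 2 * u := by rw [hs]; field_simp
  have hc' : (1 + u ^ 2) * c = u ^ 2 - 1 := by rw [hc]; field_simp
  have hsc : s ^ 2 + c ^ 2 = 1 := by rw [hs, hc]; field_simp; ring
  set J := I + (S - R) • (u • e + f) with hJ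
  obtain ⟨l, hl⟩ := hC (c • e + s • f) (s • e - c • f) u ((u + 1) / (u - 1)) J
    (by
      rw [← sq_eq_sq₀ (norm_nonneg _) zero_le_one, ← real_inner_self_eq_norm_sq]
      simp only [inner_add_left, inner_add_right, real_inner_smul_left, real_inner_smul_right,
        hee, hff, hef, hfe]
      linarith)
    (by
      rw [← sq_eq_sq₀ (norm_nonneg _) zero_le_one, ← real_inner_self_eq_norm_sq]
      simp only [inner_sub_left, inner_sub_right, real_inner_smul_left, real_inner_smul_right,
        hee, hff, hef, hfe]
      linarith)
    (by
      simp only [inner_add_left, inner_sub_right, real_inner_smul_left, real_inner_smul_right,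
        hee, hff, hef, hfe]
      ring)
    hu (by rw [lt_div_iff₀ hu₁]; linarith)
    (by
      refine le_of_eq ?_
      field_simp
      ring)
  refine ⟨l, hl.imp fun a ha x hx => ?_⟩
  obtain ⟨h₁, h₂, h₃⟩ := hx
  set ρ := circleRadius a
  set X := ⟪e, x - I⟫ with hX
  set Y := ⟪f, x - I⟫ with hY
  have hXJ : ⟪e, x - J⟫ = X - (S - R) * u := by
    rw [hJ, ← sub_sub, inner_sub_right]
    simp only [inner_add_right, real_inner_smul_right, hee, hef]
    ring
  have hYJ : ⟪f, x - J⟫ = Y - (S - R) := by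
    rw [hJ, ← sub_sub, inner_sub_right]
    simp only [inner_add_right, real_inner_smul_right, hfe, hff]
    ring
  simp only [inner_add_left, inner_sub_left, real_inner_smul_left, hXJ, hYJ] at h₁ h₂ h₃
  change ρ - S ≤ _ at h₁
  change _ * (ρ - S) ≤ _ at h₂
  change _ * (ρ - S) ≤ _ at h₃
  have k₁ : ρ - R ≤ Y := by
    have : (1 + u ^ 2) * (ρ - S) ≤ (1 + u ^ 2) * (Y - (S - R)) := by
      refine h₂.trans (le_of_eq ?_)
      rw [← hs', ← hc']
      linear_combination (1 + u ^ 2) * (Y - (S - R)) * hsc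
    linarith [le_of_mul_le_mul_left this hu₂]
  have k₂ : (1 + u ^ 2) * (ρ - R) ≤ 2 * u * X - (u ^ 2 - 1) * Y := by
    have := mul_le_mul_of_nonneg_left h₁ hu₂.le
    have h' : (1 + u ^ 2) * (s * (X - (S - R) * u) - c * (Y - (S - R))) =
        2 * u * (X - (S - R) * u) - (u ^ 2 - 1) * (Y - (S - R)) := by
      rw [← hs', ← hc']; ring
    nlinarith
  have k₃ : X + ρ ≤ (S - R) * u + S := by
    have h₃' := mul_le_mul_of_nonneg_left h₃ (sq_nonneg (u - 1))
    have e₁ : (u - 1) ^ 2 * ((1 + ((u + 1) / (u - 1)) ^ 2) * (ρ - S)) =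
        2 * (1 + u ^ 2) * (ρ - S) := by
      field_simp
      ring
    have e₂ : ∀ p q : ℝ, (u - 1) ^ 2 * (-(2 * ((u + 1) / (u - 1)) * p) -
        (((u + 1) / (u - 1)) ^ 2 - 1) * q) = -2 * ((u ^ 2 - 1) * p + 2 * u * q) := by
      intro p q
      field_simp
      ring
    rw [e₁, e₂, ← hs', ← hc'] at h₃'
    have : (1 + u ^ 2) * (ρ - S) ≤ (1 + u ^ 2) * (-(X - (S - R) * u)) := by
      have e₃ : (1 + u ^ 2) * (X - (S - R) * u) * (s ^ 2 + c ^ 2) =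
          (1 + u ^ 2) * (X - (S - R) * u) := by rw [hsc, mul_one]
      nlinarith
    linarith [le_of_mul_le_mul_left this hu₂]
  exact ⟨⟨k₁, k₂, diskInTriangle_of_constraints hu hv (hρ a ha) k₂ k₃⟩, k₃⟩

theorem packsNonacute (V : Type*) [NormedAddCommGroup V] [InnerProductSpace ℝ V]
    (C : Multiset ℝ) (hpos : ∀ c ∈ C, 0 < c) : PacksNonacute V C := by
  induction hn : C.card using Nat.strong_induction_on generalizing C with
  | _ n ih =>
  intro e f u v I he hf hef hu hv huv
  rcases lt_trichotomy C.card 1 with h1 | h1 | h1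
  · obtain rfl : C = 0 := Multiset.card_eq_zero.1 (by omega)
    exact ⟨[], by simp [IsPacking]⟩
  · obtain ⟨a, rfl⟩ := Multiset.card_eq_one.1 h1
    exact ⟨[(a, I)], by simp [IsPacking, DiskInTriangle]⟩
  have huv₀ : 0 < u * v - 1 := by nlinarith
  have hw₁ : 0 < v * (u - 1) := by nlinarith
  have hw₂ : 0 < u * (v - 1) := by nlinarith
  have hw := weights_bound hu hv huv
  obtain ⟨C₁, C₂, rfl, hC₁, hC₂, h₁, h₂⟩ :=
    exists_greedy_split (pow_pos hw₁ 2) (pow_pos hw₂ 2) C hpos h1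
  have hpos₁ : ∀ c ∈ C₁, 0 < c := fun c hc => hpos c (Multiset.mem_add.2 (Or.inl hc))
  have hpos₂ : ∀ c ∈ C₂, 0 < c := fun c hc => hpos c (Multiset.mem_add.2 (Or.inr hc))
  rw [Multiset.card_add] at hn
  have hcard₁ := Multiset.card_pos.2 hC₁
  have hcard₂ := Multiset.card_pos.2 hC₂
  have ih₁ := ih _ (by omega) C₁ hpos₁ rfl
  have ih₂ := ih _ (by omega) C₂ hpos₂ rfl
  have hs₁ : 0 ≤ C₁.sum := Multiset.sum_nonneg fun c hc => (hpos₁ c hc).le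
  have hs₂ : 0 ≤ C₂.sum := Multiset.sum_nonneg fun c hc => (hpos₂ c hc).le
  rw [Multiset.sum_add]
  set R := circleRadius (C₁.sum + C₂.sum) with hR
  have hπ := Real.pi_pos
  have q₁ := pi_mul_circleRadius_sq hs₁
  have q₂ := pi_mul_circleRadius_sq hs₂
  have q := pi_mul_circleRadius_sq (add_nonneg hs₁ hs₂)
  rw [← hR] at q
  have hsq : circleRadius C₁.sum ^ 2 + circleRadius C₂.sum ^ 2 = R ^ 2 :=
    mul_left_cancel₀ hπ.ne' (by linarith)
  obtain ⟨l₁, hl₁⟩ := exists_corner_packing ih₁ (R := R) I he hf hef hu hv (by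
    intro c hc
    have qc := pi_mul_circleRadius_sq (hpos₁ c hc).le
    convert overhang_bound (D := u * v - 1) hw₁ (by linarith) hw₂ (by linarith)
      (circleRadius_nonneg c) (circleRadius_nonneg C₁.sum)
      (circleRadius_mono (by linarith) : _ ≤ R) ?_ using 2
    · ring
    · refine le_of_mul_le_mul_left ?_ hπ
      have := h₁ c hc
      rw [← hsq]
      rw [← qc, ← q₁, ← q₂] at this
      linarith)
  obtain ⟨l₂, hl₂⟩ := exists_corner_packing (e := -e) ih₂ (R := R) I (by rwa [norm_neg]) hf
    (by rw [inner_neg_left, hef, neg_zero]) hv hu (by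
    intro c hc
    have qc := pi_mul_circleRadius_sq (hpos₂ c hc).le
    convert overhang_bound (D := v * u - 1) hw₂ (by linarith) hw₁ (by linarith)
      (circleRadius_nonneg c) (circleRadius_nonneg C₂.sum)
      (circleRadius_mono (by linarith) : _ ≤ R) ?_ using 2
    · ring
    · refine le_of_mul_le_mul_left ?_ hπ
      have := h₂ c hc
      rw [← hsq]
      rw [← qc, ← q₁, ← q₂] at this
      linarith)
  refine ⟨l₁ ++ l₂, hl₁.append hl₂ (fun _ _ h => h.1) (fun _ _ h => h.1.flip) ?_⟩
  rintro x ρ y σ ⟨-, hx⟩ ⟨-, hy⟩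
  have hb := base_lengths_le (by linarith) (by linarith) huv (circleRadius_nonneg _) hsq
  rw [inner_neg_left] at hy
  have hd : ⟪e, y - x⟫ ≤ dist x y := by
    have := real_inner_le_norm e (y - x)
    rwa [he, one_mul, ← dist_eq_norm, dist_comm] at this
  have hyx : ⟪e, y - x⟫ = ⟪e, y - I⟫ - ⟪e, x - I⟫ := by
    rw [← inner_sub_right, sub_sub_sub_cancel_right]
  rw [hyx] at hd
  linarith

lemma exists_adapted_frame {d w : Plane} (hd : d ≠ 0) (hw : ∀ t : ℝ, w ≠ t • d) :
    ∃ e f : Plane, ‖e‖ = 1 ∧ ‖f‖ = 1 ∧ ⟪e, f⟫ = 0 ∧ d = ‖d‖ • e ∧ 0 < ⟪f, w⟫ ∧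
      ∀ z : Plane, z = ⟪e, z⟫ • e + ⟪f, z⟫ • f := by
  have hd' : ‖d‖ ≠ 0 := norm_ne_zero_iff.2 hd
  set e : Plane := ‖d‖⁻¹ • d with he
  have hde : d = ‖d‖ • e := by rw [he, smul_smul, mul_inv_cancel₀ hd', one_smul]
  have he₁ : ‖e‖ = 1 := by rw [he, norm_smul, norm_inv, norm_norm, inv_mul_cancel₀ hd']
  have he₂ : e 0 ^ 2 + e 1 ^ 2 = 1 := by
    have := EuclideanSpace.real_norm_sq_eq e
    rw [he₁, Fin.sum_univ_two] at this
    linarith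
  set g : Plane := !₂[-e 1, e 0] with hg
  have hg₁ : ‖g‖ = 1 := by
    rw [← sq_eq_sq₀ (norm_nonneg _) zero_le_one, EuclideanSpace.real_norm_sq_eq,
      Fin.sum_univ_two]
    simp [hg]
    linarith
  have heg : ⟪e, g⟫ = 0 := by
    simp [PiLp.inner_apply, Fin.sum_univ_two, hg]
    ring
  have hspan : ∀ z : Plane, z = ⟪e, z⟫ • e + ⟪g, z⟫ • g := by
    intro z
    ext i
    fin_cases i <;> simp [PiLp.inner_apply, Fin.sum_univ_two, hg]
    · linear_combination (-z 0) * he₂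
    · linear_combination (-z 1) * he₂
  rcases lt_trichotomy ⟪g, w⟫ 0 with h | h | h
  · refine ⟨e, -g, he₁, by rwa [norm_neg], by rw [inner_neg_right, heg, neg_zero], hde,
      by rw [inner_neg_left]; linarith, fun z => ?_⟩
    rw [inner_neg_left, neg_smul_neg]
    exact hspan z
  · refine absurd ?_ (hw (⟪e, w⟫ * ‖d‖⁻¹))
    rw [mul_smul, ← he]
    conv_lhs => rw [hspan w, h, zero_smul, add_zero]
  · exact ⟨e, g, he₁, hg₁, heg, hde, h, hspan⟩

/-- Containment of a disk in the triangle with vertices `A`, `A + (p + q) e` and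
`A + p e + h f`, from its three side constraints. -/
lemma DiskInTriangle.closedBall_subset {e f A : Plane} {p q h b a R ρ : ℝ} {x : Plane}
    (he : ‖e‖ = 1) (hf : ‖f‖ = 1) (hef : ⟪e, f⟫ = 0)
    (hspan : ∀ z : Plane, z = ⟪e, z⟫ • e + ⟪f, z⟫ • f)
    (hp : 0 < p) (hq : 0 < q) (hh : 0 < h) (hb : 0 < b) (ha : 0 < a)
    (hb₂ : b ^ 2 = p ^ 2 + h ^ 2) (ha₂ : a ^ 2 = q ^ 2 + h ^ 2)
    (hR : R * (a + b + (p + q)) ≤ h * (p + q)) (hρ : 0 ≤ ρ)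
    (H : DiskInTriangle e f ((b + p) / h) ((a + q) / h)
      (A + (R * ((b + p) / h)) • e + R • f) R x ρ) :
    Metric.closedBall x ρ ⊆
      convexHull ℝ ({A, A + (p + q) • e, A + p • e + h • f} : Set Plane) := by
  intro z hz
  have hee : ⟪e, e⟫ = 1 := by rw [real_inner_self_eq_norm_sq, he, one_pow]
  have hff : ⟪f, f⟫ = 1 := by rw [real_inner_self_eq_norm_sq, hf, one_pow]
  have hfe : ⟪f, e⟫ = 0 := by rw [real_inner_comm, hef]
  set u := (b + p) / h with hu
  set v := (a + q) / h with hv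
  have hu' : h * u = b + p := by rw [hu]; field_simp
  have hv' : h * v = a + q := by rw [hv]; field_simp
  have hRuv : R * (u + v) ≤ p + q := by
    refine le_of_mul_le_mul_left ?_ hh
    rw [show h * (R * (u + v)) = R * (h * u + h * v) by ring, hu', hv']
    linarith
  have hpu : 2 * u * p = (u ^ 2 - 1) * h := by
    have : h * (2 * u * p) = h * ((u ^ 2 - 1) * h) := by
      rw [show h * (2 * u * p) = 2 * (h * u) * p by ring,
        show h * ((u ^ 2 - 1) * h) = (h * u) ^ 2 - h ^ 2 by ring, hu']
      linarith
    exact mul_left_cancel₀ hh.ne' this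
  have hqv : 2 * v * q = (v ^ 2 - 1) * h := by
    have : h * (2 * v * q) = h * ((v ^ 2 - 1) * h) := by
      rw [show h * (2 * v * q) = 2 * (h * v) * q by ring,
        show h * ((v ^ 2 - 1) * h) = (h * v) ^ 2 - h ^ 2 by ring, hv']
      linarith
    exact mul_left_cancel₀ hh.ne' this
  have hu₀ : 0 < u := by positivity
  have hv₀ : 0 < v := by positivity
  set X := ⟪e, z - A⟫ with hX
  set Y := ⟪f, z - A⟫ with hY
  set I := A + (R * u) • e + R • f with hI
  obtain ⟨h₁, h₂, h₃⟩ := H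
  set dx := ⟪e, z - x⟫ with hdx
  set dy := ⟪f, z - x⟫ with hdy
  have hX' : ⟪e, x - I⟫ = X - R * u - dx := by
    rw [show x - I = (z - A) - (z - x) - ((R * u) • e + R • f) by rw [hI]; abel]
    simp only [inner_sub_right _ _ ((R * u) • e + R • f), inner_sub_right _ (z - A),
      inner_add_right, real_inner_smul_right, hee, hef]
    ring
  have hY' : ⟪f, x - I⟫ = Y - R - dy := by
    rw [show x - I = (z - A) - (z - x) - ((R * u) • e + R • f) by rw [hI]; abel]
    simp only [inner_sub_right _ _ ((R * u) • e + R • f), inner_sub_right _ (z - A),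
      inner_add_right, real_inner_smul_right, hff, hfe]
    ring
  have hnorm : dx ^ 2 + dy ^ 2 ≤ ρ ^ 2 := by
    have hz' : ‖z - x‖ ≤ ρ := by rwa [Metric.mem_closedBall, dist_eq_norm] at hz
    have e₁ : ‖z - x‖ ^ 2 = dx ^ 2 + dy ^ 2 := by
      rw [← real_inner_self_eq_norm_sq]
      nth_rw 1 [hspan (z - x)]
      rw [inner_add_left, real_inner_smul_left, real_inner_smul_left]
      ring
    rw [← e₁]
    gcongr
  have hbound : ∀ α β N : ℝ, 0 ≤ N → α ^ 2 + β ^ 2 = N ^ 2 → -(N * ρ) ≤ α * dx + β * dy := by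
    intro α β N hN hαβ
    refine (abs_le.1 (abs_le_of_sq_le_sq ?_ (by positivity))).1
    have k₁ : 0 ≤ (α * dy - β * dx) ^ 2 := sq_nonneg _
    have k₂ := mul_le_mul_of_nonneg_left hnorm (sq_nonneg N)
    rw [← hαβ] at k₂
    rw [mul_pow, ← hαβ]
    linarith
  rw [hX', hY'] at h₂ h₃
  rw [hY'] at h₁
  have hY₀ : 0 ≤ Y := by
    have := hbound 0 1 1 zero_le_one (by norm_num)
    linarith
  have hAC : 0 ≤ h * X - p * Y := by
    have k := hbound (2 * u) (-(u ^ 2 - 1)) (1 + u ^ 2) (by positivity) (by ring)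
    have k' : 0 ≤ 2 * u * X - (u ^ 2 - 1) * Y := by linarith
    have : 0 ≤ 2 * u * (h * X - p * Y) := by
      have := mul_nonneg hh.le k'
      linear_combination this + Y * hpu
    exact nonneg_of_mul_nonneg_right this (by positivity)
  have hBC : 0 ≤ h * (p + q - X) - q * Y := by
    have k := hbound (-(2 * v)) (-(v ^ 2 - 1)) (1 + v ^ 2) (by positivity) (by ring)
    have k' : 0 ≤ 2 * v * (p + q - X) - (v ^ 2 - 1) * Y := by
      have := mul_le_mul_of_nonneg_left hRuv hv₀.le
      linarith
    have : 0 ≤ 2 * v * (h * (p + q - X) - q * Y) := by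
      have := mul_nonneg hh.le k'
      linear_combination this + Y * hqv
    exact nonneg_of_mul_nonneg_right this (by positivity)
  have hpq : 0 < p + q := by positivity
  have hmem : z = ((h * (p + q - X) - q * Y) / (h * (p + q))) • A +
      ((h * X - p * Y) / (h * (p + q))) • (A + (p + q) • e) +
      (Y / h) • (A + p • e + h • f) := by
    have hz₁ : z = A + (X • e + Y • f) := by
      rw [← hspan (z - A)]
      abel
    rw [hz₁]
    match_scalars <;> field_simp <;> ring
  rw [hmem]
  have hconv := convex_convexHull ℝ ({A, A + (p + q) • e, A + p • e + h • f} : Set Plane)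
  have hsub := subset_convexHull ℝ ({A, A + (p + q) • e, A + p • e + h • f} : Set Plane)
  have := hconv.sum_mem (t := Finset.univ)
    (w := ![(h * (p + q - X) - q * Y) / (h * (p + q)), (h * X - p * Y) / (h * (p + q)), Y / h])
    (z := ![A, A + (p + q) • e, A + p • e + h • f])
    (by
      intro i _
      fin_cases i
      · exact div_nonneg hBC (by positivity)
      · exact div_nonneg hAC (by positivity)
      · exact div_nonneg hY₀ hh.le)
    (by
      simp [Fin.sum_univ_three]
      field_simp
      ring)
    (by
      intro i _
      fin_cases i <;> exact hsub (by simp))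
  simpa [Fin.sum_univ_three] using this

lemma half_angle_bounds {p q h a b : ℝ} (hh : 0 < h) (hp : 0 < p) (hq : 0 < q) (hb : 0 < b)
    (ha : 0 < a) (hb₂ : b ^ 2 = p ^ 2 + h ^ 2) (ha₂ : a ^ 2 = q ^ 2 + h ^ 2)
    (hpq : h ^ 2 ≤ p * q) :
    1 < (b + p) / h ∧ 1 < (a + q) / h ∧
      1 + (b + p) / h + (a + q) / h ≤ (b + p) / h * ((a + q) / h) := by
  have hbh : h < b := lt_of_pow_lt_pow_left₀ 2 hb.le (by nlinarith)
  have hah : h < a := lt_of_pow_lt_pow_left₀ 2 ha.le (by nlinarith)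
  refine ⟨by rw [lt_div_iff₀ hh]; linarith, by rw [lt_div_iff₀ hh]; linarith, ?_⟩
  have key : h * ((b + p) + (a + q)) ≤ (b + p) * (a + q) - h ^ 2 := by
    have hU : h < b + p := by linarith
    have hW : h < a + q := by linarith
    apply le_of_sq_le_sq _ (by nlinarith)
    have e₁ : (b + p) ^ 2 - h ^ 2 = 2 * p * (b + p) := by linarith
    have e₂ : (a + q) ^ 2 - h ^ 2 = 2 * q * (a + q) := by linarith
    have e₃ : ((b + p) ^ 2 - h ^ 2) * ((a + q) ^ 2 - h ^ 2) =
        2 * p * (b + p) * (2 * q * (a + q)) := by rw [e₁, e₂]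
    have e₄ : 0 ≤ 4 * ((b + p) * (a + q)) * (p * q - h ^ 2) :=
      mul_nonneg (by positivity) (sub_nonneg.2 hpq)
    linarith
  rw [← sub_nonneg]
  have : (b + p) / h * ((a + q) / h) - (1 + (b + p) / h + (a + q) / h) =
      ((b + p) * (a + q) - h ^ 2 - h * ((b + p) + (a + q))) / h ^ 2 := by
    field_simp
    ring
  rw [this]
  exact div_nonneg (by linarith) (by positivity)

lemma incircleArea_eq {p q h a b : ℝ} (hh : 0 < h) (hp : 0 < p) (hq : 0 < q) (hb : 0 < b)
    (ha : 0 < a) (hb₂ : b ^ 2 = p ^ 2 + h ^ 2) (ha₂ : a ^ 2 = q ^ 2 + h ^ 2) :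
    incircleArea (p + q) a b = Real.pi * (h * (p + q) / (a + b + (p + q))) ^ 2 := by
  have hheron : heronArea (p + q) a b = h * (p + q) / 2 := by
    rw [heronArea, Real.sqrt_eq_iff_mul_self_eq_of_pos (by positivity)]
    have e₁ : (p + q + a + b) / 2 * ((p + q + a + b) / 2 - (p + q)) *
        ((p + q + a + b) / 2 - a) * ((p + q + a + b) / 2 - b) =
        (4 * (p + q) ^ 2 * b ^ 2 - ((p + q) ^ 2 + b ^ 2 - a ^ 2) ^ 2) / 16 := by ring
    rw [e₁, hb₂, ha₂]
    ring
  rw [incircleArea, hheron]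
  congr 2
  field_simp
  ring

lemma incircleArea_rotate (x y z : ℝ) : incircleArea x y z = incircleArea y z x := by
  unfold incircleArea heronArea
  congr 3
  · congr 1; ring
  · ring

lemma packs_of_angle_at_third {A B D : Plane}
    (hncol : ¬ Collinear ℝ ({A, B, D} : Set Plane))
    (hang : Real.pi / 2 ≤ EuclideanGeometry.angle A D B)
    (C : Multiset ℝ) (hpos : ∀ c ∈ C, 0 < c)
    (hsum : C.sum ≤ incircleArea (dist A B) (dist B D) (dist D A)) :
    Packs C (convexHull ℝ ({A, B, D} : Set Plane)) := by
  have hd : B - A ≠ 0 := by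
    intro h0
    rw [sub_eq_zero.1 h0, Set.insert_eq_of_mem (by simp)] at hncol
    exact hncol (collinear_pair _ _ _)
  have hw : ∀ t : ℝ, D - A ≠ t • (B - A) := by
    intro t ht
    refine hncol ((collinear_iff_of_mem (p₀ := A) (by simp)).2 ⟨B - A, ?_⟩)
    intro y hy
    rcases hy with rfl | rfl | rfl
    · exact ⟨0, by simp⟩
    · exact ⟨1, by simp⟩
    · exact ⟨t, by rw [← ht]; simp⟩
  obtain ⟨e, f, he, hf, hef, hde, hh, hspan⟩ := exists_adapted_frame hd hw
  have hee : ⟪e, e⟫ = 1 := by rw [real_inner_self_eq_norm_sq, he, one_pow]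
  have hff : ⟪f, f⟫ = 1 := by rw [real_inner_self_eq_norm_sq, hf, one_pow]
  have hfe : ⟪f, e⟫ = 0 := by rw [real_inner_comm, hef]
  set h := ⟪f, D - A⟫
  set p := ⟪e, D - A⟫
  obtain ⟨q, hq⟩ : ∃ q, ‖B - A‖ = p + q := ⟨‖B - A‖ - p, by ring⟩
  have hc : 0 < p + q := hq ▸ norm_pos_iff.2 hd
  have hB : B = A + (p + q) • e := by rw [← hq, ← hde]; abel
  have hD : D = A + p • e + h • f := by
    rw [add_assoc, ← hspan (D - A)]; abel
  have hsq : ∀ α β : ℝ, ‖α • e + β • f‖ ^ 2 = α ^ 2 + β ^ 2 := by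
    intro α β
    rw [← real_inner_self_eq_norm_sq]
    simp only [inner_add_left, inner_add_right, real_inner_smul_left, real_inner_smul_right,
      hee, hff, hef, hfe]
    ring
  have hpq : h ^ 2 ≤ p * q := by
    have k := InnerProductGeometry.cos_angle_mul_norm_mul_norm (A - D) (B - D)
    have hcos : Real.cos (InnerProductGeometry.angle (A - D) (B - D)) ≤ 0 :=
      Real.cos_nonpos_of_pi_div_two_le_of_le hang
        ((InnerProductGeometry.angle_le_pi _ _).trans (by linarith [Real.pi_pos]))
    have hle : ⟪A - D, B - D⟫ ≤ 0 := k ▸ mul_nonpos_of_nonpos_of_nonneg hcos (by positivity)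
    rw [show A - D = (-p) • e + (-h) • f by rw [hD]; module,
      show B - D = q • e + (-h) • f by rw [hB, hD]; module] at hle
    simp only [inner_add_left, inner_add_right, real_inner_smul_left, real_inner_smul_right,
      hee, hff, hef, hfe] at hle
    linarith
  have hp : 0 < p := by nlinarith
  have hq₀ : 0 < q := by nlinarith
  have hb₂ : dist D A ^ 2 = p ^ 2 + h ^ 2 := by
    rw [dist_eq_norm, hspan (D - A), hsq]
  have ha₂ : dist B D ^ 2 = q ^ 2 + h ^ 2 := by
    rw [dist_eq_norm, show B - D = q • e + (-h) • f by rw [hB, hD]; module, hsq, neg_sq]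
  have hb : 0 < dist D A := lt_of_pow_lt_pow_left₀ 2 dist_nonneg
    (by rw [hb₂, zero_pow two_ne_zero]; positivity)
  have ha : 0 < dist B D := lt_of_pow_lt_pow_left₀ 2 dist_nonneg
    (by rw [ha₂, zero_pow two_ne_zero]; positivity)
  rw [dist_comm A B, dist_eq_norm B A, hq, incircleArea_eq hh hp hq₀ hb ha hb₂ ha₂] at hsum
  set b := dist D A
  set a := dist B D
  obtain ⟨hu, hv, huv⟩ := half_angle_bounds hh hp hq₀ hb ha hb₂ ha₂ hpq
  have hC₀ : 0 ≤ C.sum := Multiset.sum_nonneg fun c hc => (hpos c hc).le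
  have hR : circleRadius C.sum * (a + b + (p + q)) ≤ h * (p + q) := by
    rw [← le_div_iff₀ (by positivity)]
    refine le_of_sq_le_sq (le_of_mul_le_mul_left ?_ Real.pi_pos) (by positivity)
    rwa [pi_mul_circleRadius_sq hC₀]
  obtain ⟨l, hl₁, hl₂, hl₃⟩ := packsNonacute Plane C hpos e f _ _
    (A + (circleRadius C.sum * ((b + p) / h)) • e + circleRadius C.sum • f) he hf hef hu hv huv
  refine ⟨l, hl₁, fun x hx => ?_, hl₃.imp fun hxy => Metric.ball_disjoint_ball hxy⟩
  rw [hD, hB]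
  exact (hl₂ x hx).closedBall_subset he hf hef hspan hp hq₀ hh hb ha hb₂ ha₂ hR
    (circleRadius_nonneg _)

/-- Packing direction of the main triangle theorem: every finite multiset of positive
circle areas whose sum is at most the incircle area of a non-acute triangle can be
packed into the triangle. -/
theorem circles_pack_into_nonacute_triangle (p₁ p₂ p₃ : Plane)
    (hncol : ¬ Collinear ℝ ({p₁, p₂, p₃} : Set Plane))
    (hnonacute : Real.pi / 2 ≤ EuclideanGeometry.angle p₂ p₁ p₃ ∨
      Real.pi / 2 ≤ EuclideanGeometry.angle p₁ p₂ p₃ ∨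
      Real.pi / 2 ≤ EuclideanGeometry.angle p₁ p₃ p₂)
    (a : ℝ) (ha : a = incircleArea (dist p₁ p₂) (dist p₂ p₃) (dist p₃ p₁))
    (C : Multiset ℝ) (hpos : ∀ c ∈ C, 0 < c) (hsum : C.sum ≤ a) :
    Packs C (convexHull ℝ ({p₁, p₂, p₃} : Set Plane)) := by
  subst ha
  rcases hnonacute with hang | hang | hang
  · rw [show ({p₁, p₂, p₃} : Set Plane) = {p₂, p₃, p₁} by grind] at hncol ⊢
    rw [incircleArea_rotate] at hsum
    exact packs_of_angle_at_third hncol hang C hpos hsum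
  · rw [show ({p₁, p₂, p₃} : Set Plane) = {p₃, p₁, p₂} by grind] at hncol ⊢
    rw [incircleArea_rotate, incircleArea_rotate] at hsum
    exact packs_of_angle_at_third hncol (by rwa [EuclideanGeometry.angle_comm]) C hpos hsum
  · exact packs_of_angle_at_third hncol hang C hpos hsum
end
end

section
/- (Weighted Split Packing theorem.) Let 0 ≤ b ≤ a and let S ⊆ ℝ². Suppose there exist positive reals f₁, f₂ such that for all (a, b, (f₁,f₂))-conjugated tuples (a₁, b₁), (a₂, b₂) there exist subsets S₁, S₂ ⊆ S with disjoint interiors such that S₁ is a 𝔺(a₁, b₁)-shape and S₂ is a 𝔺(a₂, b₂)-shape. Then S is a 𝔺(a, b)-shape. -/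
noncomputable section

/-- `S` is a `𝔺(a,b)`-shape: every finite multiset of positive reals with sum at most `a`
and every element at least `b` can be packed into `S`. -/
def IsCShape (a b : ℝ) (S : Set Plane) : Prop :=
  ∀ C : Multiset ℝ, (∀ c ∈ C, 0 < c) → C.sum ≤ a → (∀ c ∈ C, b ≤ c) → Packs C S

/-- Tuples `(a₁,b₁)`, `(a₂,b₂)` are `(a, b, (f₁,f₂))`-conjugated. -/
def Conjugated (a b f₁ f₂ a₁ b₁ a₂ b₂ : ℝ) : Prop :=
  a₁ + a₂ = a ∧ b ≤ b₁ ∧ b ≤ b₂ ∧ a₁ - f₁ * a₂ / f₂ ≤ b₁ ∧ a₂ - f₂ * a₁ / f₁ ≤ b₂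

/-- Greedy weighted splitting of an increasing list of positive reals: each element of a part
is at least the excess of that part over the proportional share given by the other part. -/
lemma exists_greedy_split_s8 {f₁ f₂ : ℝ} (hf₁ : 0 < f₁) (hf₂ : 0 < f₂) (l : List ℝ)
    (hl : l.Pairwise (· ≤ ·)) (hpos : ∀ c ∈ l, 0 < c) :
    ∃ C₁ C₂ : Multiset ℝ, C₁ + C₂ = (l : Multiset ℝ) ∧
      (∀ c ∈ C₁, C₁.sum - f₁ * C₂.sum / f₂ ≤ c) ∧
      (∀ c ∈ C₂, C₂.sum - f₂ * C₁.sum / f₁ ≤ c) := by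
  induction l with
  | nil => exact ⟨0, 0, by simp, by simp, by simp⟩
  | cons x t ih =>
    rw [List.pairwise_cons] at hl
    obtain ⟨C₁, C₂, hC, h₁, h₂⟩ := ih hl.2 fun c hc => hpos c (List.mem_cons_of_mem _ hc)
    have hx : 0 < x := hpos x List.mem_cons_self
    have hle : ∀ c ∈ C₁ + C₂, x ≤ c := fun c hc => hl.1 c (by simpa [hC] using hc)
    rcases le_total (C₁.sum * f₂) (f₁ * C₂.sum) with hs | hs
    · refine ⟨x ::ₘ C₁, C₂, by rw [Multiset.cons_add, hC, Multiset.cons_coe], ?_, ?_⟩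
      · have hbal : C₁.sum ≤ f₁ * C₂.sum / f₂ := (le_div_iff₀ hf₂).2 hs
        intro c hc
        have hxc : x ≤ c := by
          rcases Multiset.mem_cons.1 hc with rfl | hc
          · exact le_rfl
          · exact hle c (Multiset.mem_add.2 (Or.inl hc))
        rw [Multiset.sum_cons]
        linarith
      · intro c hc
        have hmono : f₂ * C₁.sum / f₁ ≤ f₂ * (x + C₁.sum) / f₁ := by
          gcongr
          linarith
        rw [Multiset.sum_cons]
        linarith [h₂ c hc]
    · refine ⟨C₁, x ::ₘ C₂, by rw [Multiset.add_cons, hC, Multiset.cons_coe], ?_, ?_⟩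
      · intro c hc
        have hmono : f₁ * C₂.sum / f₂ ≤ f₁ * (x + C₂.sum) / f₂ := by
          gcongr
          linarith
        rw [Multiset.sum_cons]
        linarith [h₁ c hc]
      · have hbal : C₂.sum ≤ f₂ * C₁.sum / f₁ := (le_div_iff₀ hf₁).2 (by linarith)
        intro c hc
        have hxc : x ≤ c := by
          rcases Multiset.mem_cons.1 hc with rfl | hc
          · exact le_rfl
          · exact hle c (Multiset.mem_add.2 (Or.inr hc))
        rw [Multiset.sum_cons]
        linarith

/-- Distribute a total `a ≥ s₁ + s₂` over two parts without increasing a positive excess of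
either part over its proportional share. -/
lemma exists_budget_split {f₁ f₂ a s₁ s₂ : ℝ} (hf₁ : 0 < f₁) (hf₂ : 0 < f₂)
    (hs : s₁ + s₂ ≤ a) :
    ∃ a₁ a₂ : ℝ, a₁ + a₂ = a ∧ s₁ ≤ a₁ ∧ s₂ ≤ a₂ ∧
      a₁ - f₁ * a₂ / f₂ ≤ max 0 (s₁ - f₁ * s₂ / f₂) ∧
      a₂ - f₂ * a₁ / f₁ ≤ max 0 (s₂ - f₂ * s₁ / f₁) := by
  have hf : 0 < f₁ + f₂ := add_pos hf₁ hf₂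
  rcases le_or_gt s₁ (f₁ * a / (f₁ + f₂)) with h₁ | h₁
  · rcases le_or_gt s₂ (f₂ * a / (f₁ + f₂)) with h₂ | h₂
    · refine ⟨f₁ * a / (f₁ + f₂), f₂ * a / (f₁ + f₂), by field_simp, h₁, h₂,
        le_max_of_le_left (le_of_eq ?_), le_max_of_le_left (le_of_eq ?_)⟩ <;>
      · field_simp
        ring
    · refine ⟨a - s₂, s₂, by ring, by linarith, le_rfl, le_max_of_le_left ?_,
        le_max_of_le_right ?_⟩
      · rw [div_lt_iff₀ hf] at h₂
        rw [sub_nonpos, le_div_iff₀ hf₂]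
        linarith
      · gcongr
        linarith
  · refine ⟨s₁, a - s₁, by ring, le_rfl, by linarith, le_max_of_le_right ?_,
      le_max_of_le_left ?_⟩
    · gcongr
      linarith
    · rw [div_lt_iff₀ hf] at h₁
      rw [sub_nonpos, le_div_iff₀ hf₁]
      linarith

/-- Packings into subsets with disjoint interiors combine to a packing of the sum. -/
lemma Packs.add {C₁ C₂ : Multiset ℝ} {S S₁ S₂ : Set Plane} (h₁ : Packs C₁ S₁)
    (h₂ : Packs C₂ S₂) (hS₁ : S₁ ⊆ S) (hS₂ : S₂ ⊆ S)
    (hd : Disjoint (interior S₁) (interior S₂)) : Packs (C₁ + C₂) S := by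
  obtain ⟨l₁, rfl, hb₁, hp₁⟩ := h₁
  obtain ⟨l₂, rfl, hb₂, hp₂⟩ := h₂
  refine ⟨l₁ ++ l₂, by simp, ?_, List.pairwise_append.2 ⟨hp₁, hp₂, ?_⟩⟩
  · intro p hp
    rcases List.mem_append.1 hp with hp | hp
    · exact (hb₁ p hp).trans hS₁
    · exact (hb₂ p hp).trans hS₂
  · intro p hp q hq
    exact hd.mono
      (interior_maximal (Metric.ball_subset_closedBall.trans (hb₁ p hp)) Metric.isOpen_ball)
      (interior_maximal (Metric.ball_subset_closedBall.trans (hb₂ q hq)) Metric.isOpen_ball)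

/-- The Weighted Split Packing theorem. -/
theorem weighted_split_packing (a b : ℝ) (hb : 0 ≤ b) (hba : b ≤ a) (S : Set Plane)
    (h : ∃ f₁ f₂ : ℝ, 0 < f₁ ∧ 0 < f₂ ∧
      ∀ a₁ b₁ a₂ b₂ : ℝ, 0 ≤ a₁ → 0 ≤ b₁ → 0 ≤ a₂ → 0 ≤ b₂ →
        Conjugated a b f₁ f₂ a₁ b₁ a₂ b₂ →
        ∃ S₁ S₂ : Set Plane, S₁ ⊆ S ∧ S₂ ⊆ S ∧
          Disjoint (interior S₁) (interior S₂) ∧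
          IsCShape a₁ b₁ S₁ ∧ IsCShape a₂ b₂ S₂) :
    IsCShape a b S := by
  obtain ⟨f₁, f₂, hf₁, hf₂, h⟩ := h
  intro C hpos hsum hbC
  obtain ⟨C₁, C₂, hC, h₁, h₂⟩ := exists_greedy_split_s8 hf₁ hf₂ (C.sort (· ≤ ·))
    (C.pairwise_sort _) fun c hc => hpos c ((Multiset.mem_sort _).1 hc)
  rw [Multiset.sort_eq] at hC
  subst hC
  have hpos₁ : ∀ c ∈ C₁, 0 < c := fun c hc => hpos c (Multiset.mem_add.2 (Or.inl hc))
  have hpos₂ : ∀ c ∈ C₂, 0 < c := fun c hc => hpos c (Multiset.mem_add.2 (Or.inr hc))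
  rw [Multiset.sum_add] at hsum
  obtain ⟨a₁, a₂, ha, hs₁, hs₂, he₁, he₂⟩ := exists_budget_split hf₁ hf₂ hsum
  obtain ⟨S₁, S₂, hS₁, hS₂, hd, hshape₁, hshape₂⟩ :=
    h a₁ (max b (a₁ - f₁ * a₂ / f₂)) a₂ (max b (a₂ - f₂ * a₁ / f₁))
      ((Multiset.sum_nonneg fun c hc => (hpos₁ c hc).le).trans hs₁) (le_max_of_le_left hb)
      ((Multiset.sum_nonneg fun c hc => (hpos₂ c hc).le).trans hs₂) (le_max_of_le_left hb)
      ⟨ha, le_max_left _ _, le_max_left _ _, le_max_right _ _, le_max_right _ _⟩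
  refine Packs.add (hshape₁ C₁ hpos₁ hs₁ fun c hc => max_le ?_ ?_)
    (hshape₂ C₂ hpos₂ hs₂ fun c hc => max_le ?_ ?_) hS₁ hS₂ hd
  · exact hbC c (Multiset.mem_add.2 (Or.inl hc))
  · exact he₁.trans (max_le (hpos₁ c hc).le (h₁ c hc))
  · exact hbC c (Multiset.mem_add.2 (Or.inr hc))
  · exact he₂.trans (max_le (hpos₂ c hc).le (h₂ c hc))
end
end

section
/- For all reals b, a₁, a₂ with 0 ≤ b ≤ a₁ ≤ a₂, a right isosceles (a₁, b)-hat and a right isosceles (a₂, max(a₂−a₁, b))-hat can be packed into a right isosceles (a₁+a₂, b)-hat, i.e., there exist isometries g₁, g₂ of ℝ² mapping the two hats to subsets of the (a₁+a₂, b)-hat whose interiors are disjoint. -/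
noncomputable section

def pt (x y : ℝ) : Plane := (WithLp.equiv 2 (Fin 2 → ℝ)).symm ![x, y]

/-- The union of all closed disks of radius `s` contained in `T`
(`T` with its corners rounded to radius `s`). -/
def roundCorners (s : ℝ) (T : Set Plane) : Set Plane :=
  ⋃ c ∈ {c : Plane | Metric.closedBall c s ⊆ T}, Metric.closedBall c s

/-- A closed isosceles right triangle whose incircle has area `a`:
right angle at the origin, legs of length `(2+√2)·√(a/π)` along the axes. -/
def rightIsoTriangle (a : ℝ) : Set Plane :=
  convexHull ℝ {pt 0 0, pt ((2 + Real.sqrt 2) * Real.sqrt (a / Real.pi)) 0,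
    pt 0 ((2 + Real.sqrt 2) * Real.sqrt (a / Real.pi))}

/-- The right isosceles `(a,b)`-hat: the isosceles right triangle with incircle area `a`,
with its corners rounded to the radius `√(b/π)` of a circle of area `b`. -/
def rightIsoHat (a b : ℝ) : Set Plane :=
  roundCorners (Real.sqrt (b / Real.pi)) (rightIsoTriangle a)

/-- The right triangle with its right angle at the origin and legs of length `l` along the axes,
given by inequalities. -/
def legTriangle (l : ℝ) : Set Plane := {p | 0 ≤ p 0 ∧ 0 ≤ p 1 ∧ p 0 + p 1 ≤ l}

@[simp] lemma pt_apply_zero (x y : ℝ) : pt x y 0 = x := rfl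

@[simp] lemma pt_apply_one (x y : ℝ) : pt x y 1 = y := rfl

lemma Plane.ext_coords {p q : Plane} (h₀ : p 0 = q 0) (h₁ : p 1 = q 1) : p = q := by
  ext i
  fin_cases i <;> assumption

lemma Plane.dist_eq (p q : Plane) : dist p q = √((p 0 - q 0) ^ 2 + (p 1 - q 1) ^ 2) := by
  simp [EuclideanSpace.dist_eq, Fin.sum_univ_two, Real.dist_eq, sq_abs]

lemma Plane.mem_closedBall {p c : Plane} {r : ℝ} (hr : 0 ≤ r) :
    p ∈ Metric.closedBall c r ↔ (p 0 - c 0) ^ 2 + (p 1 - c 1) ^ 2 ≤ r ^ 2 := by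
  rw [Metric.mem_closedBall, Plane.dist_eq, Real.sqrt_le_left hr]

lemma convexHull_eq_legTriangle {l : ℝ} (hl : 0 ≤ l) :
    convexHull ℝ {pt 0 0, pt l 0, pt 0 l} = legTriangle l := by
  apply subset_antisymm
  · apply convexHull_min
    · rintro p (rfl | rfl | rfl) <;> simp [legTriangle, hl]
    · rintro p ⟨hp₀, hp₁, hp⟩ q ⟨hq₀, hq₁, hq⟩ α β hα hβ hαβ
      simp only [legTriangle, Set.mem_ofPred_eq, PiLp.add_apply, PiLp.smul_apply, smul_eq_mul]
      refine ⟨by positivity, by positivity, ?_⟩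
      calc _ = α * (p 0 + p 1) + β * (q 0 + q 1) := by ring
        _ ≤ α * l + β * l := by gcongr
        _ = l := by rw [← add_mul, hαβ, one_mul]
  · rintro p ⟨hp₀, hp₁, hp⟩
    rcases hl.eq_or_lt with rfl | hl
    · have h : p = pt 0 0 := Plane.ext_coords (by simp; linarith) (by simp; linarith)
      exact subset_convexHull ℝ _ (by simp [h])
    · rw [convexHull_insert (by simp), convexHull_pair]
      rcases (add_nonneg hp₀ hp₁).eq_or_lt with hs | hs
      · have h : p = pt 0 0 := Plane.ext_coords (by simp; linarith) (by simp; linarith)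
        rw [h]
        exact subset_convexJoin_left ⟨_, left_mem_segment ℝ _ _⟩ rfl
      · rw [mem_convexJoin]
        refine ⟨pt 0 0, rfl, pt (p 0 / (p 0 + p 1) * l) (p 1 / (p 0 + p 1) * l),
          ⟨p 0 / (p 0 + p 1), p 1 / (p 0 + p 1), by positivity, by positivity, by field_simp, ?_⟩,
          ⟨1 - (p 0 + p 1) / l, (p 0 + p 1) / l,
            sub_nonneg.2 ((div_le_one hl).2 hp), by positivity, by ring, ?_⟩⟩
        · apply Plane.ext_coords <;> simp
        · apply Plane.ext_coords <;> simp <;> field_simp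

lemma rightIsoTriangle_eq_legTriangle (a : ℝ) :
    rightIsoTriangle a = legTriangle ((2 + √2) * √(a / Real.pi)) :=
  convexHull_eq_legTriangle (by positivity)

lemma roundCorners_subset (s : ℝ) (T : Set Plane) : roundCorners s T ⊆ T :=
  Set.iUnion₂_subset fun _ hc => hc

lemma roundCorners_subset_of_le {s u : ℝ} (hs : 0 ≤ s) (hsu : s ≤ u) (T : Set Plane) :
    roundCorners u T ⊆ roundCorners s T := by
  rcases hsu.eq_or_lt with rfl | hlt
  · rfl
  have hu : 0 < u := hs.trans_lt hlt
  apply Set.iUnion₂_subset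
  intro c hc x hx
  rw [Metric.mem_closedBall, dist_comm] at hx
  have hk : 0 ≤ 1 - s / u := sub_nonneg.2 ((div_le_one hu).2 hsu)
  refine Set.mem_iUnion₂.2 ⟨AffineMap.lineMap c x (1 - s / u),
    (Metric.closedBall_subset_closedBall' ?_).trans hc, ?_⟩
  · rw [dist_lineMap_left, Real.norm_of_nonneg hk]
    calc s + (1 - s / u) * dist c x ≤ s + (1 - s / u) * u := by gcongr
      _ = u := by field_simp; ring
  · rw [Metric.mem_closedBall, dist_comm, dist_lineMap_right, sub_sub_cancel,
      Real.norm_of_nonneg (by positivity)]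
    calc s / u * dist c x ≤ s / u * u := by gcongr
      _ = s := by field_simp

lemma image_roundCorners_subset (g : Plane ≃ᵢ Plane) {u : ℝ} {T T' : Set Plane}
    (h : ∀ c, Metric.closedBall c u ⊆ T → g '' Metric.closedBall c u ⊆ T') :
    g '' roundCorners u T ⊆ roundCorners u T' := by
  rw [roundCorners, Set.image_iUnion₂]
  refine Set.iUnion₂_subset fun c hc => ?_
  have := h c hc
  rw [g.image_closedBall] at this ⊢
  exact Set.subset_biUnion_of_mem (u := fun c => Metric.closedBall c u) this

lemma bounds_of_closedBall_subset_legTriangle {c : Plane} {u l : ℝ} (hu : 0 ≤ u)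
    (h : Metric.closedBall c u ⊆ legTriangle l) : u ≤ c 0 ∧ c 0 + c 1 + √2 * u ≤ l := by
  have h2 : √2 ^ 2 = 2 := Real.sq_sqrt (by norm_num)
  constructor
  · have := (h ((Plane.mem_closedBall (p := pt (c 0 - u) (c 1)) hu).2 (by simp))).1
    simpa using this
  · have := (h ((Plane.mem_closedBall (p := pt (c 0 + √2 / 2 * u) (c 1 + √2 / 2 * u)) hu).2
      (by simp only [pt_apply_zero, pt_apply_one]; ring_nf; rw [h2]; linarith))).2.2
    simp only [pt_apply_zero, pt_apply_one] at this
    linarith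

/-- The reflection with linear part `(x, y) ↦ ((x - y) / √2, -(x + y) / √2)` that carries the
right triangle with legs `l` into the corner `(L, 0)` of the right triangle with legs `L`,
putting its hypotenuse on the first axis. -/
def cornerReflection (l L : ℝ) : Plane ≃ᵢ Plane where
  toFun p := pt (L - √2 / 2 * (l - p 0 + p 1)) (√2 / 2 * (l - p 0 - p 1))
  invFun q := pt (l + √2 / 2 * (q 0 - L - q 1)) (√2 / 2 * (L - q 0 - q 1))
  left_inv p := by
    have h2 : √2 ^ 2 = 2 := Real.sq_sqrt (by norm_num)
    apply Plane.ext_coords <;> simp only [pt_apply_zero, pt_apply_one] <;> ring_nf <;> rw [h2] <;>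
      ring
  right_inv p := by
    have h2 : √2 ^ 2 = 2 := Real.sq_sqrt (by norm_num)
    apply Plane.ext_coords <;> simp only [pt_apply_zero, pt_apply_one] <;> ring_nf <;> rw [h2] <;>
      ring
  isometry_toFun := Isometry.of_dist_eq fun p q => by
    have h2 : √2 ^ 2 = 2 := Real.sq_sqrt (by norm_num)
    rw [Plane.dist_eq, Plane.dist_eq]
    congr 1
    simp only [pt_apply_zero, pt_apply_one]
    ring_nf
    rw [h2]
    ring

lemma cornerReflection_apply (l L : ℝ) (p : Plane) :
    cornerReflection l L p =
      pt (L - √2 / 2 * (l - p 0 + p 1)) (√2 / 2 * (l - p 0 - p 1)) := rfl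

lemma cornerReflection_image_roundCorners_subset {s u l L : ℝ} (hs : 0 ≤ s) (hsu : s ≤ u)
    (h : 2 * l - 2 * u ≤ √2 * L) :
    cornerReflection l L '' roundCorners u (legTriangle l) ⊆ roundCorners s (legTriangle L) := by
  have hu := hs.trans hsu
  refine (image_roundCorners_subset _ fun c hc => ?_).trans (roundCorners_subset_of_le hs hsu _)
  rintro _ ⟨p, hp, rfl⟩
  obtain ⟨hp₀, hp₁, hpl⟩ := hc hp
  obtain ⟨hcu, hcl⟩ := bounds_of_closedBall_subset_legTriangle hu hc
  rw [Plane.mem_closedBall hu] at hp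
  have h2 : √2 ^ 2 = 2 := Real.sq_sqrt (by norm_num)
  have hpos : 0 < √2 := by positivity
  have hdiff : (c 0 - p 0) - (c 1 - p 1) ≤ √2 * u := by
    refine le_of_abs_le (abs_le_of_sq_le_sq ?_ (by positivity))
    rw [mul_pow, h2]
    nlinarith [sq_nonneg ((c 0 - p 0) + (c 1 - p 1))]
  refine ⟨?_, mul_nonneg (by positivity) (by linarith), ?_⟩ <;>
    simp only [cornerReflection_apply, pt_apply_zero, pt_apply_one]
  · have : √2 / 2 * (l - p 0 + p 1) ≤ √2 / 2 * (√2 * L) := by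
      gcongr
      linarith
    nlinarith
  · nlinarith [mul_nonneg hpos.le hp₁]

/-- The reflection exchanging the two coordinates. -/
def coordSwap : Plane ≃ᵢ Plane :=
  (LinearIsometryEquiv.piLpCongrLeft 2 ℝ ℝ (Equiv.swap (0 : Fin 2) 1)).toIsometryEquiv

@[simp] lemma coordSwap_apply_zero (p : Plane) : coordSwap p 0 = p 1 := rfl

@[simp] lemma coordSwap_apply_one (p : Plane) : coordSwap p 1 = p 0 := rfl

lemma coordSwap_image_roundCorners_subset (s l : ℝ) :
    coordSwap '' roundCorners s (legTriangle l) ⊆ roundCorners s (legTriangle l) := by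
  refine image_roundCorners_subset _ fun c hc => ?_
  rintro _ ⟨p, hp, rfl⟩
  obtain ⟨hp₀, hp₁, hpl⟩ := hc hp
  exact ⟨hp₁, hp₀, by simpa [add_comm] using hpl⟩

lemma disjoint_interior_of_coord_sub {A B : Set Plane} {d : ℝ}
    (hA : ∀ p ∈ A, d ≤ p 1 - p 0) (hB : ∀ p ∈ B, p 1 - p 0 ≤ d) :
    Disjoint (interior A) (interior B) := by
  rw [Set.disjoint_left]
  intro p hpA hpB
  have hd := hA p (interior_subset hpA)
  obtain ⟨ε, hε, hball⟩ := Metric.isOpen_iff.1 isOpen_interior p hpB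
  have hmem : pt (p 0) (p 1 + ε / 2) ∈ Metric.ball p ε := by
    rw [Metric.mem_ball, Plane.dist_eq]
    simpa [Real.sqrt_sq_eq_abs, abs_of_pos (half_pos hε)] using hε
  have := hB _ (interior_subset (hball hmem))
  simp only [pt_apply_zero, pt_apply_one] at this
  linarith

/-- A disk of radius `t` in the `45°` corner of a right isosceles triangle of inradius `x` stays
inside the right isosceles triangle of inradius `R` sharing the other `45°` corner. -/
lemma inradius_bound {r x t R : ℝ} (hr : 0 ≤ r) (hrx : r ≤ x) (ht : 0 ≤ t) (hR : 0 ≤ R)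
    (hsum : r ^ 2 + x ^ 2 = R ^ 2) (htx : t ^ 2 = x ^ 2 - r ^ 2) :
    (2 + √2) * x - t ≤ (1 + √2) * R := by
  have h2 : √2 ^ 2 = 2 := Real.sq_sqrt (by norm_num)
  have hxR : x ≤ R := by nlinarith
  have hRx : R ≤ √2 * x := by
    have hx := hr.trans hrx
    refine le_of_abs_le (abs_le_of_sq_le_sq ?_ (by positivity))
    nlinarith
  have hprod : 0 ≤ (4 + 2 * √2) * ((R - x) * (√2 * x - R)) :=
    mul_nonneg (by positivity) (mul_nonneg (by linarith) (by linarith))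
  have hle : (2 + √2) * x - (1 + √2) * R ≤ t := by
    refine le_of_abs_le (abs_le_of_sq_le_sq ?_ ht)
    have key : x ^ 2 - r ^ 2 - ((2 + √2) * x - (1 + √2) * R) ^ 2 =
        (4 + 2 * √2) * ((R - x) * (√2 * x - R)) := by
      linear_combination (-1 : ℝ) * hsum + (x ^ 2 - R ^ 2) * h2
    linarith
  linarith

/-- A right isosceles `(a₁,b)`-hat and a right isosceles `(a₂,max(a₂−a₁,b))`-hat can be
packed into a right isosceles `(a₁+a₂,b)`-hat. -/
theorem rounded_right_hats_in_right_hat (b a₁ a₂ : ℝ)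
    (hb : 0 ≤ b) (h₁ : b ≤ a₁) (h₂ : a₁ ≤ a₂) :
    ∃ g₁ g₂ : Plane ≃ᵢ Plane,
      g₁ '' rightIsoHat a₁ b ⊆ rightIsoHat (a₁ + a₂) b ∧
      g₂ '' rightIsoHat a₂ (max (a₂ - a₁) b) ⊆ rightIsoHat (a₁ + a₂) b ∧
      Disjoint (interior (g₁ '' rightIsoHat a₁ b))
               (interior (g₂ '' rightIsoHat a₂ (max (a₂ - a₁) b))) := by
  simp only [rightIsoHat, rightIsoTriangle_eq_legTriangle]
  have h2 : √2 ^ 2 = 2 := Real.sq_sqrt (by norm_num)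
  have hmono : ∀ {x y : ℝ}, x ≤ y → √(x / Real.pi) ≤ √(y / Real.pi) := fun h =>
    Real.sqrt_le_sqrt (by gcongr)
  have hsq : ∀ {x : ℝ}, 0 ≤ x → √(x / Real.pi) ^ 2 = x / Real.pi := fun h =>
    Real.sq_sqrt (by positivity)
  have hbound := inradius_bound (Real.sqrt_nonneg (a₁ / Real.pi)) (hmono h₂)
    (Real.sqrt_nonneg ((a₂ - a₁) / Real.pi)) (Real.sqrt_nonneg ((a₁ + a₂) / Real.pi))
    (by rw [hsq (by linarith), hsq (by linarith), hsq (by linarith)]; ring)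
    (by rw [hsq (by linarith), hsq (by linarith), hsq (by linarith)]; ring)
  have hadd : √(a₁ / Real.pi) + √(a₂ / Real.pi) ≤ √2 * √((a₁ + a₂) / Real.pi) := by
    refine le_of_abs_le (abs_le_of_sq_le_sq ?_ (by positivity))
    have h := sq_nonneg (√(a₁ / Real.pi) - √(a₂ / Real.pi))
    have hs : √(a₁ / Real.pi) ^ 2 + √(a₂ / Real.pi) ^ 2 = √((a₁ + a₂) / Real.pi) ^ 2 := by
      rw [hsq (by linarith), hsq (by linarith), hsq (by linarith)]; ring
    rw [mul_pow, h2]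
    linarith
  have hr := hmono h₂
  have htu := hmono (le_max_left (a₂ - a₁) b)
  have hsu := hmono (le_max_right (a₂ - a₁) b)
  have hs := Real.sqrt_nonneg (b / Real.pi)
  set s := √(b / Real.pi)
  set u := √(max (a₂ - a₁) b / Real.pi)
  set r₁ := √(a₁ / Real.pi)
  set r₂ := √(a₂ / Real.pi)
  set R := √((a₁ + a₂) / Real.pi)
  have hlegs : (2 + √2) * r₁ + (2 + √2) * r₂ ≤ √2 * ((2 + √2) * R) := by
    calc _ = (2 + √2) * (r₁ + r₂) := by ring
      _ ≤ (2 + √2) * (√2 * R) := by gcongr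
      _ = _ := by ring
  have hleg : (2 + √2) * r₁ ≤ (2 + √2) * r₂ := by gcongr
  refine ⟨(cornerReflection ((2 + √2) * r₁) ((2 + √2) * R)).trans coordSwap,
    cornerReflection ((2 + √2) * r₂) ((2 + √2) * R), ?_,
    cornerReflection_image_roundCorners_subset hs hsu ?_,
    disjoint_interior_of_coord_sub (d := √2 * ((2 + √2) * r₂) - (2 + √2) * R) ?_ ?_⟩
  · change coordSwap ∘ cornerReflection _ _ '' _ ⊆ _
    rw [Set.image_comp]
    exact (Set.image_mono (cornerReflection_image_roundCorners_subset hs le_rfl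
      (by linarith))).trans (coordSwap_image_roundCorners_subset _ _)
  · have h : √2 * ((2 + √2) * R) = 2 * ((1 + √2) * R) := by
      linear_combination R * h2
    rw [h]
    linarith
  · rintro _ ⟨p, hp, rfl⟩
    have hp₀ := (roundCorners_subset _ _ hp).1
    simp only [IsometryEquiv.trans_apply, coordSwap_apply_zero, coordSwap_apply_one,
      cornerReflection_apply, pt_apply_zero, pt_apply_one]
    have h := mul_le_mul_of_nonneg_left hlegs (Real.sqrt_nonneg 2)
    rw [← mul_assoc √2 √2, ← sq, h2] at h
    linarith [mul_nonneg (Real.sqrt_nonneg 2) hp₀]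
  · rintro _ ⟨p, hp, rfl⟩
    have hp₀ := (roundCorners_subset _ _ hp).1
    simp only [cornerReflection_apply, pt_apply_zero, pt_apply_one]
    linarith [mul_nonneg (Real.sqrt_nonneg 2) hp₀]
end
end
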